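/- Fix ρ ∈ (0, 1] and, for c ∈ [0, 1] with ρ·c < 1, let λ_c = ρ·c/√(1 − ρ²c²) and let H*(·; c) be the cumulative distribution function of the skew normal distribution SN(λ_c). Then for any c, c′ ∈ [0, 1] with ρ·c < 1 and ρ·c′ < 1: H*(x; c) ≤ H*(x; c′) for all x ∈ ℝ if and only if c ≥ c′. (In the MODEL, H*(·; c*(a)) is the limiting distribution of welfare Wⁿ under weight allocation a with asymptotic cosine proportionality c*(a); hence the asymptotic stochastic welfare order over weight allocations coincides with the total order induced by asymptotic cosine proportionality.) -/

import Mathlib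

open MeasureTheory ProbabilityTheory Real Filter
open scoped ENNReal NNReal Topology

noncomputable section

/-- Density of the standard normal distribution. -/
def stdPDF (x : ℝ) : ℝ := Real.exp (-x ^ 2 / 2) / Real.sqrt (2 * Real.pi)

/-- Cumulative distribution function of the standard normal distribution. -/
def stdCDF (x : ℝ) : ℝ := ∫ y in Set.Iic x, stdPDF y

/-- Density of the skew normal distribution with parameter `l`. -/
def skewPDF (l x : ℝ) : ℝ := 2 * stdPDF x * stdCDF (l * x)

/-- Cumulative distribution function of the skew normal distribution `SN(l)`. -/
def skewCDF (l x : ℝ) : ℝ := ∫ y in Set.Iic x, skewPDF l y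

lemma stdPDF_pos (x : ℝ) : 0 < stdPDF x := by
  unfold stdPDF; positivity

lemma stdPDF_neg (x : ℝ) : stdPDF (-x) = stdPDF x := by
  simp [stdPDF]

lemma integrable_stdPDF : Integrable stdPDF := by
  have h := (integrable_exp_neg_mul_sq (b := 1 / 2) (by norm_num)).div_const (√(2 * π))
  refine h.congr (ae_of_all _ fun x => ?_)
  simp only [stdPDF]
  congr 2
  ring

lemma strictMono_stdCDF : StrictMono stdCDF := by
  intro a b hab
  have h := intervalIntegral.integral_Iic_sub_Iic (μ := volume)
    (integrable_stdPDF.integrableOn (s := Set.Iic a))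
    (integrable_stdPDF.integrableOn (s := Set.Iic b))
  have hpos := intervalIntegral.intervalIntegral_pos_of_pos
    (integrable_stdPDF.intervalIntegrable (a := a) (b := b)) stdPDF_pos hab
  unfold stdCDF
  linarith

lemma stdCDF_nonneg (x : ℝ) : 0 ≤ stdCDF x :=
  integral_nonneg fun y => (stdPDF_pos y).le

lemma stdCDF_add_stdCDF_neg (x : ℝ) : stdCDF x + stdCDF (-x) = ∫ y, stdPDF y := by
  have h : stdCDF (-x) = ∫ y in Set.Ioi x, stdPDF y := by
    have h' := integral_comp_neg_Iic (-x) stdPDF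
    simpa only [stdCDF, stdPDF_neg, neg_neg] using h'
  rw [h]
  exact intervalIntegral.integral_Iic_add_Ioi integrable_stdPDF.integrableOn
    integrable_stdPDF.integrableOn

lemma integrable_skewPDF (l : ℝ) : Integrable (skewPDF l) := by
  have hm : AEStronglyMeasurable (fun x => stdCDF (l * x)) volume :=
    (strictMono_stdCDF.monotone.measurable.comp (measurable_const_mul l)).aestronglyMeasurable
  refine (integrable_stdPDF.const_mul 2).mul_bdd (c := ∫ y, stdPDF y) hm (ae_of_all _ fun x => ?_)
  rw [Real.norm_of_nonneg (stdCDF_nonneg _)]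
  linarith [stdCDF_add_stdCDF_neg (l * x), stdCDF_nonneg (-(l * x))]

/-- The difference of two skew normal densities is an odd function. -/
lemma skewPDF_sub_skewPDF_neg (l m x : ℝ) :
    skewPDF l (-x) - skewPDF m (-x) = -(skewPDF l x - skewPDF m x) := by
  simp only [skewPDF, stdPDF_neg, mul_neg]
  have h₁ := stdCDF_add_stdCDF_neg (l * x)
  have h₂ := stdCDF_add_stdCDF_neg (m * x)
  linear_combination 2 * stdPDF x * (h₁ - h₂)

lemma skewCDF_sub_skewCDF (l m x : ℝ) :
    skewCDF l x - skewCDF m x = ∫ y in Set.Iic x, (skewPDF l y - skewPDF m y) :=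
  (integral_sub (integrable_skewPDF l).integrableOn (integrable_skewPDF m).integrableOn).symm

/-- The difference of two skew normal distribution functions is an even function. -/
lemma skewCDF_sub_skewCDF_neg (l m x : ℝ) :
    skewCDF l (-x) - skewCDF m (-x) = skewCDF l x - skewCDF m x := by
  have hD : Integrable fun y => skewPDF l y - skewPDF m y :=
    (integrable_skewPDF l).sub (integrable_skewPDF m)
  have h := intervalIntegral.integral_Iic_sub_Iic (μ := volume)
    (hD.integrableOn (s := Set.Iic (-x))) (hD.integrableOn (s := Set.Iic x))
  have h0 := intervalIntegral.integral_comp_neg (a := -x) (b := x)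
    fun y => skewPDF l y - skewPDF m y
  simp only [skewPDF_sub_skewPDF_neg, intervalIntegral.integral_neg, neg_neg] at h0
  rw [skewCDF_sub_skewCDF, skewCDF_sub_skewCDF]
  linarith

lemma skewCDF_lt_of_nonpos {l m x : ℝ} (h : m < l) (hx : x ≤ 0) : skewCDF l x < skewCDF m x := by
  have hlt : ∀ y < 0, skewPDF l y < skewPDF m y := fun y hy =>
    mul_lt_mul_of_pos_left (strictMono_stdCDF (mul_lt_mul_of_neg_right h hy))
      (mul_pos two_pos (stdPDF_pos y))
  have hD : Integrable fun y => skewPDF m y - skewPDF l y :=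
    (integrable_skewPDF m).sub (integrable_skewPDF l)
  rw [← sub_pos, skewCDF_sub_skewCDF, integral_Iic_eq_integral_Iio,
    setIntegral_pos_iff_support_of_nonneg_ae _ hD.integrableOn]
  · refine lt_of_lt_of_le ?_ (measure_mono (s := Set.Iio x) fun y hy => ⟨?_, hy⟩)
    · simp
    · exact (sub_pos.2 (hlt y (lt_of_lt_of_le hy hx))).ne'
  · filter_upwards [ae_restrict_mem measurableSet_Iio] with y hy
    exact (sub_pos.2 (hlt y (lt_of_lt_of_le hy hx))).le

lemma strictAnti_skewCDF (x : ℝ) : StrictAnti fun l => skewCDF l x := by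
  intro m l h
  rcases le_total x 0 with hx | hx
  · exact skewCDF_lt_of_nonpos h hx
  · have h₁ := skewCDF_lt_of_nonpos h (neg_nonpos.2 hx)
    have h₂ := skewCDF_sub_skewCDF_neg l m x
    simp only
    linarith

lemma div_sqrt_one_sub_sq_lt {a b : ℝ} (ha : 0 ≤ a) (hab : a < b) (hb : b < 1) :
    a / √(1 - a ^ 2) < b / √(1 - b ^ 2) := by
  have hb' : 0 < 1 - b ^ 2 := by nlinarith
  have h : √(1 - b ^ 2) ≤ √(1 - a ^ 2) := Real.sqrt_le_sqrt (by nlinarith)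
  exact div_lt_div₀ hab h (ha.trans hab.le) (Real.sqrt_pos.2 hb')

/-- Theorem 1 of the paper, asymptotic equivalence: fix `ρ ∈ (0,1]` and,
for `c ∈ [0,1]` with `ρ·c < 1`, let `H*(·; c)` be the CDF of `SN(ρ·c/√(1 − ρ²c²))`, the
limiting welfare distribution under a weight allocation of asymptotic cosine
proportionality `c`. Then `H*(·; c)` stochastically dominates `H*(·; c')` iff `c ≥ c'`. -/
theorem stmt4 (ρ : ℝ) (hρ0 : 0 < ρ) (hρ1 : ρ ≤ 1)
    (c c' : ℝ) (hc : c ∈ Set.Icc (0 : ℝ) 1) (hc' : c' ∈ Set.Icc (0 : ℝ) 1)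
    (hρc : ρ * c < 1) (hρc' : ρ * c' < 1) :
    (∀ x : ℝ,
        skewCDF (ρ * c / Real.sqrt (1 - ρ ^ 2 * c ^ 2)) x ≤
          skewCDF (ρ * c' / Real.sqrt (1 - ρ ^ 2 * c' ^ 2)) x)
      ↔ c' ≤ c := by
  have hmono : StrictMonoOn (fun c : ℝ => ρ * c / Real.sqrt (1 - ρ ^ 2 * c ^ 2))
      {c | 0 ≤ c ∧ ρ * c < 1} := by
    intro a ha b hb hab
    have h := div_sqrt_one_sub_sq_lt (mul_nonneg hρ0.le ha.1) (mul_lt_mul_of_pos_left hab hρ0) hb.2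
    simpa only [mul_pow] using h
  rw [← hmono.le_iff_le ⟨hc'.1, hρc'⟩ ⟨hc.1, hρc⟩]
  exact ⟨fun h => (strictAnti_skewCDF 0).le_iff_ge.1 (h 0),
    fun h x => (strictAnti_skewCDF x).le_iff_ge.2 h⟩
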